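/- The set function α is monotone and nonnegative: for all subsets A ⊆ B of the index set {1,…,n}, one has 0 = α(∅) ≤ α(A) ≤ α(B); equivalently, 1 ≤ det(I + P·D_A·Σ·D_A) ≤ det(I + P·D_B·Σ·D_B). -/

import Mathlib

open Matrix ComplexOrder

namespace Matrix

variable {n 𝕜 : Type*} [Fintype n] [DecidableEq n] [RCLike 𝕜]

open scoped MatrixOrder in
lemma PosSemidef.exists_eq_conjTranspose_mul_self {W : Matrix n n 𝕜} (hW : W.PosSemidef) :
    ∃ M : Matrix n n 𝕜, W = Mᴴ * M :=
  CStarAlgebra.nonneg_iff_eq_star_mul_self.mp hW.nonneg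

lemma IsHermitian.det_one_add_eq_prod_eigenvalues {W : Matrix n n 𝕜} (hW : W.IsHermitian) :
    (1 + W).det = ∏ i, (1 + (hW.eigenvalues i : 𝕜)) := by
  conv_lhs =>
    rw [hW.spectral_theorem, ← map_one (Unitary.conjStarAlgAut 𝕜 _ hW.eigenvectorUnitary),
      ← map_add, Unitary.conjStarAlgAut_apply, det_mul_right_comm]
  simp [← diagonal_one, diagonal_add]

lemma PosSemidef.one_le_det_one_add {W : Matrix n n 𝕜} (hW : W.PosSemidef) :
    1 ≤ (1 + W).det := by
  rw [hW.isHermitian.det_one_add_eq_prod_eigenvalues]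
  norm_cast
  exact Finset.one_le_prod fun i _ => le_add_of_nonneg_right (hW.eigenvalues_nonneg i)

lemma PosDef.det_le_det_add {A W : Matrix n n 𝕜} (hA : A.PosDef) (hW : W.PosSemidef) :
    A.det ≤ (A + W).det := by
  obtain ⟨M, rfl⟩ := hW.exists_eq_conjTranspose_mul_self
  rw [det_add_mul _ _ ((isUnit_iff_isUnit_det A).mp hA.isUnit)]
  exact le_mul_of_one_le_right hA.det_pos.le
    (hA.inv.posSemidef.mul_mul_conjTranspose_same M).one_le_det_one_add

/-- For idempotents `E` and `F` with `E` and `F - E` positive semidefinite, compressing a positive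
semidefinite `W` by `F` gives at least as large a `det (1 + ·)` as compressing it by `E`. -/
lemma PosSemidef.det_one_add_compression_le {W E F : Matrix n n 𝕜} (hW : W.PosSemidef)
    (hE : E.PosSemidef) (hEF : (F - E).PosSemidef)
    (hE' : IsIdempotentElem E) (hF' : IsIdempotentElem F) :
    (1 + E * W * E).det ≤ (1 + F * W * F).det := by
  obtain ⟨M, rfl⟩ := hW.exists_eq_conjTranspose_mul_self
  have key {G : Matrix n n 𝕜} (hG : IsIdempotentElem G) :
      (1 + G * (Mᴴ * M) * G).det = (1 + M * G * Mᴴ).det := by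
    rw [show G * (Mᴴ * M) * G = (G * Mᴴ) * (M * G) by noncomm_ring, det_one_add_mul_comm,
      show M * G * (G * Mᴴ) = M * (G * G) * Mᴴ by noncomm_ring, hG.eq]
  have hsub : 1 + M * F * Mᴴ = 1 + M * E * Mᴴ + M * (F - E) * Mᴴ := by noncomm_ring
  rw [key hE', key hF', hsub]
  exact (PosDef.one.add_posSemidef (hE.mul_mul_conjTranspose_same M)).det_le_det_add
    (hEF.mul_mul_conjTranspose_same M)

end Matrix

/-- Monotonicity and nonnegativity of `α(A) = log det(I + P·D_A·Σ·D_A)` for a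
Hermitian positive semidefinite matrix `Σ` (here `S`) and `P ≥ 0`, where `D_A`
is the diagonal 0-1 matrix of the subset `A`: for `A ⊆ B`,
`0 = α(∅) ≤ α(A) ≤ α(B)`, equivalently
`1 ≤ det(I + P·D_A·Σ·D_A) ≤ det(I + P·D_B·Σ·D_B)`. -/
theorem alpha_monotone_nonneg (n : ℕ) (S : Matrix (Fin n) (Fin n) ℂ)
    (hS : S.PosSemidef) (P : ℝ) (hP : 0 ≤ P)
    (D : Finset (Fin n) → Matrix (Fin n) (Fin n) ℂ)
    (hD : ∀ A, D A = Matrix.diagonal (fun i => if i ∈ A then (1 : ℂ) else 0))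
    (α : Finset (Fin n) → ℝ)
    (hα : ∀ A, α A = Real.log ((1 + (P : ℂ) • (D A * S * D A)).det.re)) :
    α ∅ = 0 ∧
    ∀ A B : Finset (Fin n), A ⊆ B →
      (0 ≤ α A ∧ α A ≤ α B) ∧
      1 ≤ (1 + (P : ℂ) • (D A * S * D A)).det.re ∧
      (1 + (P : ℂ) • (D A * S * D A)).det.re ≤
        (1 + (P : ℂ) • (D B * S * D B)).det.re := by
  have hW : ((P : ℂ) • S).PosSemidef := hS.smul (by exact_mod_cast hP)
  have hD_idem (A) : IsIdempotentElem (D A) := by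
    simp [IsIdempotentElem, hD, diagonal_mul_diagonal]
  have hD_sub {A B} (hAB : A ⊆ B) : (D B - D A).PosSemidef := by
    rw [hD, hD, diagonal_sub]
    refine PosSemidef.diagonal fun i => ?_
    by_cases hA : i ∈ A
    · simp [hA, hAB hA]
    · by_cases hB : i ∈ B <;> simp [hA, hB]
  have hD_empty : D ∅ = 0 := by simp [hD]
  have hD_pos (A) : (D A).PosSemidef := by
    simpa [hD_empty] using hD_sub (Finset.empty_subset A)
  have hdet {A B} (hAB : A ⊆ B) : (1 + (P : ℂ) • (D A * S * D A)).det.re ≤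
      (1 + (P : ℂ) • (D B * S * D B)).det.re := by
    have h := hW.det_one_add_compression_le (hD_pos A) (hD_sub hAB) (hD_idem A) (hD_idem B)
    simp only [Matrix.mul_smul, Matrix.smul_mul] at h
    exact (Complex.le_def.mp h).1
  have hone (A) : 1 ≤ (1 + (P : ℂ) • (D A * S * D A)).det.re := by
    simpa [hD_empty] using hdet (Finset.empty_subset A)
  refine ⟨by simp [hα, hD_empty], fun A B hAB => ⟨⟨?_, ?_⟩, hone A, hdet hAB⟩⟩
  · rw [hα]
    exact Real.log_nonneg (hone A)
  · rw [hα, hα]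
    exact Real.log_le_log (zero_lt_one.trans_le (hone A)) (hdet hAB)
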